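/- arXiv:2007.10136 — 5 statements merged into one kernel-verified Lean document; each statement's English description precedes it below -/
import Mathlib

section
/- Let Σ_Λ be a subshift of finite type with (Σ_Λ, S) topologically mixing, let φ ∈ F_Λ, and let μ be a Gibbs measure for φ. Then μ is quasi-invariant: for every involution σ ∈ H, the restrictions to Γ_σ = Σ_Λ ∩ T_σ^{-1}Σ_Λ of the measures μ and μ ∘ T_σ^{-1} are mutually absolutely continuous. -/
open MeasureTheory Filter Topology

/-- The left shift on `K^ℤ`: `(S ω) n = ω (n+1)`. -/
def shiftMap (K : Type*) : (ℤ → K) → (ℤ → K) := fun ω n => ω (n + 1)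

/-- For `τ : ℤ → ℤ`, the map `T_τ : K^ℤ → K^ℤ`, `(T_τ ω) n = ω (τ n)`. -/
def Tmap {K : Type*} (τ : ℤ → ℤ) (ω : ℤ → K) : ℤ → K := fun n => ω (τ n)

/-- A permutation of `ℤ` has finite support if it fixes all `n` with `|n| ≥ N` for some `N`. -/
def FinitelySupported (σ : Equiv.Perm ℤ) : Prop :=
  ∃ N : ℕ, ∀ n : ℤ, (N : ℤ) ≤ |n| → σ n = n

/-- The subshift of finite type `Σ_Λ = {x ∈ K^ℤ : Λ_{x_i, x_{i+1}} = 1 ∀ i}`, `K = Fin N`. -/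
def SigmaSFT {N : ℕ} (Λ : Fin N → Fin N → Bool) : Set (ℤ → Fin N) :=
  {x | ∀ i : ℤ, Λ (x i) (x (i + 1)) = true}

/-- The cylinder `{y ∈ Σ_Λ : y_j = x_j, j = 0, ..., m}`. -/
def cylSFT {N : ℕ} (Λ : Fin N → Fin N → Bool) (x : ℤ → Fin N) (m : ℕ) : Set (ℤ → Fin N) :=
  {y ∈ SigmaSFT Λ | ∀ j : ℕ, j ≤ m → y (j : ℤ) = x (j : ℤ)}

/-- `μ` is a Gibbs measure for `φ` with constants `c₁, c₂, p`: a shift-invariant probability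
measure on `Σ_Λ` with `c₁ ≤ μ[x_0 ... x_m] / exp(-pm + ∑_{j<m} φ(S^j x)) ≤ c₂`. -/
def IsGibbs {N : ℕ} (Λ : Fin N → Fin N → Bool) (φ : (ℤ → Fin N) → ℝ)
    (μ : Measure (ℤ → Fin N)) (c₁ c₂ p : ℝ) : Prop :=
  IsProbabilityMeasure μ ∧ μ (SigmaSFT Λ) = 1 ∧ μ.map (shiftMap (Fin N)) = μ ∧
  0 < c₁ ∧ 0 < c₂ ∧
  ∀ x ∈ SigmaSFT Λ, ∀ m : ℕ,
    c₁ * Real.exp (-(p * m) + ∑ j ∈ Finset.range m, φ (fun i => x (i + j))) ≤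
        (μ (cylSFT Λ x m)).toReal ∧
      (μ (cylSFT Λ x m)).toReal ≤
        c₂ * Real.exp (-(p * m) + ∑ j ∈ Finset.range m, φ (fun i => x (i + j)))

/-- The two-sided cylinder of points of `Σ_Λ` agreeing with `x` on `[-m, m]`. -/
def symmCylSFT {N : ℕ} (Λ : Fin N → Fin N → Bool) (x : ℤ → Fin N) (m : ℕ) : Set (ℤ → Fin N) :=
  {y ∈ SigmaSFT Λ | ∀ j : ℤ, |j| ≤ (m : ℤ) → y j = x j}

lemma measurable_shiftMap (N : ℕ) : Measurable (shiftMap (Fin N)) :=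
  measurable_pi_lambda _ fun _ => measurable_pi_apply _

lemma measurable_Tmap (N : ℕ) (τ : ℤ → ℤ) : Measurable (Tmap (K := Fin N) τ) :=
  measurable_pi_lambda _ fun _ => measurable_pi_apply _

lemma isClosed_SigmaSFT {N : ℕ} (Λ : Fin N → Fin N → Bool) : IsClosed (SigmaSFT Λ) := by
  have h : SigmaSFT Λ = ⋂ i : ℤ,
      (fun x : ℤ → Fin N => (x i, x (i + 1))) ⁻¹' {q | Λ q.1 q.2 = true} := by
    ext x; simp [SigmaSFT]
  rw [h]
  exact isClosed_iInter fun i => (isClosed_discrete _).preimage (by fun_prop)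

lemma measurableSet_symmCylSFT {N : ℕ} (Λ : Fin N → Fin N → Bool) (x : ℤ → Fin N) (m : ℕ) :
    MeasurableSet (symmCylSFT Λ x m) := by
  have h : symmCylSFT Λ x m = SigmaSFT Λ ∩
      ⋂ j : ℤ, ⋂ _ : |j| ≤ (m : ℤ), (fun y : ℤ → Fin N => y j) ⁻¹' {x j} := by
    ext y; simp [symmCylSFT]
  rw [h]
  exact (isClosed_SigmaSFT Λ).measurableSet.inter <| MeasurableSet.iInter fun j =>
    MeasurableSet.iInter fun _ => measurable_pi_apply j (MeasurableSet.singleton _)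

lemma shift_mem_SigmaSFT {N : ℕ} {Λ : Fin N → Fin N → Bool} {x : ℤ → Fin N}
    (hx : x ∈ SigmaSFT Λ) (t : ℤ) : (fun i => x (i + t)) ∈ SigmaSFT Λ := fun i => by
  have := hx (i + t)
  rwa [show i + t + 1 = i + 1 + t by ring] at this

lemma shiftMap_iterate {K : Type*} (m : ℕ) (x : ℤ → K) :
    (shiftMap K)^[m] x = fun i => x (i + m) := by
  induction m generalizing x with
  | zero => simp
  | succ m ih =>
    rw [Function.iterate_succ_apply, ih]
    funext i
    simp only [shiftMap]
    congr 1
    push_cast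
    ring

lemma measure_symmCylSFT {N : ℕ} {Λ : Fin N → Fin N → Bool} {μ : Measure (ℤ → Fin N)}
    (hinv : μ.map (shiftMap (Fin N)) = μ) (x : ℤ → Fin N) (m : ℕ) :
    μ (symmCylSFT Λ x m) = μ (cylSFT Λ (fun i => x (i + -(m : ℤ))) (2 * m)) := by
  have hmp : MeasurePreserving (shiftMap (Fin N))^[m] μ μ :=
    MeasurePreserving.iterate ⟨measurable_shiftMap N, hinv⟩ m
  rw [← hmp.measure_preimage (measurableSet_symmCylSFT Λ x m).nullMeasurableSet]
  congr 1
  ext z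
  simp only [Set.mem_preimage, shiftMap_iterate, symmCylSFT, cylSFT, Set.mem_ofPred_eq]
  constructor
  · rintro ⟨h1, h2⟩
    refine ⟨?_, fun j hj => ?_⟩
    · simpa using shift_mem_SigmaSFT h1 (-(m : ℤ))
    · have := h2 (j + -(m : ℤ)) (by rw [abs_le]; omega)
      simpa using this
  · rintro ⟨h1, h2⟩
    refine ⟨shift_mem_SigmaSFT h1 m, fun j hj => ?_⟩
    rw [abs_le] at hj
    have := h2 (j + m).toNat (by omega)
    rw [Int.toNat_of_nonneg (by omega)] at this
    simpa using this

/-- Ergodic sums of a potential with exponentially decaying variations differ by a uniformly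
bounded amount on points that agree outside a bounded window. -/
lemma exists_sum_le_sum_add {N : ℕ} {Λ : Fin N → Fin N → Bool} {φ : (ℤ → Fin N) → ℝ}
    (hφcont : ContinuousOn φ (SigmaSFT Λ))
    (hvar : ∃ b > (0 : ℝ), ∃ α ∈ Set.Ioo (0 : ℝ) 1, ∀ k : ℕ,
      ∀ x ∈ SigmaSFT Λ, ∀ y ∈ SigmaSFT Λ,
        (∀ j : ℤ, |j| ≤ (k : ℤ) → x j = y j) → |φ x - φ y| ≤ b * α ^ k) (L : ℕ) :
    ∃ C : ℝ, ∀ x ∈ SigmaSFT Λ, ∀ y ∈ SigmaSFT Λ, (∀ j : ℤ, (L : ℤ) ≤ |j| → x j = y j) →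
      ∀ s : Finset ℤ, ∑ t ∈ s, φ (fun i => x (i + t)) ≤ ∑ t ∈ s, φ (fun i => y (i + t)) + C := by
  obtain ⟨b, hb, α, ⟨hα0, hα1⟩, hvar⟩ := hvar
  obtain ⟨B, hB⟩ := (isClosed_SigmaSFT Λ).isCompact.exists_bound_of_continuousOn hφcont
  have hsum : Summable fun t : ℤ => (b + 2 * |B|) / α ^ L * α ^ t.natAbs := by
    refine Summable.mul_left _ (Summable.of_nat_of_neg ?_ ?_) <;>
      simpa using summable_geometric_of_lt_one hα0.le hα1
  refine ⟨∑' t : ℤ, (b + 2 * |B|) / α ^ L * α ^ t.natAbs, fun x hx y hy hxy s => ?_⟩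
  have key : ∀ t : ℤ, φ (fun i => x (i + t)) - φ (fun i => y (i + t)) ≤
      (b + 2 * |B|) / α ^ L * α ^ t.natAbs := by
    intro t
    have hL : 0 < α ^ L := pow_pos hα0 L
    rw [div_mul_eq_mul_div, le_div_iff₀ hL]
    rcases le_or_gt L t.natAbs with h | h
    · obtain ⟨k, hk⟩ := Nat.exists_eq_add_of_le h
      have := hvar k _ (shift_mem_SigmaSFT hx t) _ (shift_mem_SigmaSFT hy t)
        (fun j hj => hxy _ (by rw [abs_le] at hj; rw [le_abs]; omega))
      have h1 := (le_abs_self _).trans this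
      rw [hk, pow_add]
      have h2 : 0 ≤ |B| * (α ^ L * α ^ k) := by positivity
      nlinarith [mul_le_mul_of_nonneg_right h1 hL.le]
    · have h1 := hB _ (shift_mem_SigmaSFT hx t)
      have h2 := hB _ (shift_mem_SigmaSFT hy t)
      rw [Real.norm_eq_abs] at h1 h2
      have h3 := le_abs_self B
      have h4 : φ (fun i => x (i + t)) - φ (fun i => y (i + t)) ≤ b + 2 * |B| := by
        linarith [(abs_le.1 h1).2, (abs_le.1 h2).1]
      have h5 : α ^ L ≤ α ^ t.natAbs := pow_le_pow_of_le_one hα0.le hα1.le h.le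
      exact mul_le_mul h4 h5 hL.le (by positivity)
  rw [← sub_le_iff_le_add', ← Finset.sum_sub_distrib]
  exact (Finset.sum_le_sum fun t _ => key t).trans
    (hsum.sum_le_tsum s fun t _ => by positivity)

lemma exists_measure_symmCylSFT_le {N : ℕ} {Λ : Fin N → Fin N → Bool} {φ : (ℤ → Fin N) → ℝ}
    (hφcont : ContinuousOn φ (SigmaSFT Λ))
    (hvar : ∃ b > (0 : ℝ), ∃ α ∈ Set.Ioo (0 : ℝ) 1, ∀ k : ℕ,
      ∀ x ∈ SigmaSFT Λ, ∀ y ∈ SigmaSFT Λ,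
        (∀ j : ℤ, |j| ≤ (k : ℤ) → x j = y j) → |φ x - φ y| ≤ b * α ^ k)
    {μ : Measure (ℤ → Fin N)} {c₁ c₂ p : ℝ} (hGibbs : IsGibbs Λ φ μ c₁ c₂ p) (L : ℕ) :
    ∃ C : NNReal, ∀ x ∈ SigmaSFT Λ, ∀ y ∈ SigmaSFT Λ, (∀ j : ℤ, (L : ℤ) ≤ |j| → x j = y j) →
      ∀ m : ℕ, μ (symmCylSFT Λ x m) ≤ C * μ (symmCylSFT Λ y m) := by
  obtain ⟨hprob, -, hinv, hc₁, hc₂, hG⟩ := hGibbs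
  obtain ⟨C, hC⟩ := exists_sum_le_sum_add hφcont hvar L
  refine ⟨Real.toNNReal (c₂ / c₁ * Real.exp C), fun x hx y hy hxy m => ?_⟩
  rw [measure_symmCylSFT hinv, measure_symmCylSFT hinv]
  have hreindex : ∀ z : ℤ → Fin N,
      ∑ j ∈ Finset.range (2 * m), φ (fun i => z (i + j + -(m : ℤ))) =
        ∑ t ∈ (Finset.range (2 * m)).image (fun j : ℕ => (j : ℤ) + -(m : ℤ)),
          φ (fun i => z (i + t)) := by
    intro z
    rw [Finset.sum_image (fun a _ b _ h => by simpa using h)]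
    simp only [add_assoc]
  have hx' := (hG _ (shift_mem_SigmaSFT hx (-(m : ℤ))) (2 * m)).2
  have hy' := (hG _ (shift_mem_SigmaSFT hy (-(m : ℤ))) (2 * m)).1
  have hC' := hC x hx y hy hxy
    ((Finset.range (2 * m)).image (fun j : ℕ => (j : ℤ) + -(m : ℤ)))
  rw [← hreindex, ← hreindex] at hC'
  set X := ∑ j ∈ Finset.range (2 * m), φ (fun i => x (i + j + -(m : ℤ)))
  set Y := ∑ j ∈ Finset.range (2 * m), φ (fun i => y (i + j + -(m : ℤ)))
  rw [← ENNReal.ofReal_toReal (measure_ne_top μ (cylSFT Λ (fun i => x (i + -(m : ℤ))) (2 * m))),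
    ← ENNReal.ofReal_toReal (measure_ne_top μ (cylSFT Λ (fun i => y (i + -(m : ℤ))) (2 * m)))]
  change _ ≤ ENNReal.ofReal _ * _
  rw [← ENNReal.ofReal_mul (by positivity)]
  refine ENNReal.ofReal_le_ofReal (hx'.trans ?_)
  calc c₂ * Real.exp (-(p * ↑(2 * m)) + X)
      ≤ c₂ * Real.exp (C + (-(p * ↑(2 * m)) + Y)) := by gcongr c₂ * Real.exp ?_; linarith
    _ = c₂ / c₁ * Real.exp C * (c₁ * Real.exp (-(p * ↑(2 * m)) + Y)) := by
        rw [Real.exp_add C]; field_simp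
    _ ≤ _ := by gcongr

/-- Domination between measures on `A^ℤ` can be checked on large symmetric cylinders. -/
lemma absolutelyContinuous_of_restrict_Icc {A : Type*} [Finite A] [TopologicalSpace A]
    [DiscreteTopology A] [MeasurableSpace A] [DiscreteMeasurableSpace A]
    {ν₁ ν₂ : Measure (ℤ → A)} [IsFiniteMeasure ν₂] (C : NNReal) (L : ℕ)
    (h : ∀ m : ℕ, L ≤ m → ∀ v : Finset.Icc (-(m : ℤ)) m → A,
      ν₁ ((Finset.Icc (-(m : ℤ)) m).restrict ⁻¹' {v}) ≤
        C * ν₂ ((Finset.Icc (-(m : ℤ)) m).restrict ⁻¹' {v})) : ν₁ ≪ ν₂ := by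
  classical
  have hopen : ∀ U : Set (ℤ → A), IsOpen U → ν₁ U ≤ C * ν₂ U := by
    intro U hU
    let V : ℕ → Set (ℤ → A) := fun m =>
      {x | ∀ y : ℤ → A, (∀ j : ℤ, |j| ≤ ((m + L : ℕ) : ℤ) → y j = x j) → y ∈ U}
    have hVmono : Monotone V := by
      intro m n hmn x hx y hy
      exact hx y fun j hj => hy j (hj.trans (by push_cast; omega))
    have hVU : U = ⋃ m, V m := by
      ext x
      simp only [Set.mem_iUnion]
      constructor
      · intro hx
        obtain ⟨I, u, hu, hsub⟩ := isOpen_pi_iff.1 hU x hx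
        refine ⟨I.sup Int.natAbs, fun y hy => hsub fun j hj => ?_⟩
        rw [hy j]
        · exact (hu j hj).2
        · have : j.natAbs ≤ I.sup Int.natAbs := Finset.le_sup (f := Int.natAbs) hj
          rw [abs_le]
          omega
      · rintro ⟨m, hm⟩
        exact hm x fun _ _ => rfl
    have hVle : ∀ m, ν₁ (V m) ≤ C * ν₂ (V m) := by
      intro m
      set r := (Finset.Icc (-((m + L : ℕ) : ℤ)) ((m + L : ℕ) : ℤ)).restrict (π := fun _ => A)
        with hr
      have hrm : Measurable r := Finset.measurable_restrict _
      have hfin : (r '' V m).Finite := Set.toFinite _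
      have hV : V m = r ⁻¹' ↑hfin.toFinset := by
        rw [hfin.coe_toFinset]
        refine (Set.subset_preimage_image r (V m)).antisymm ?_
        rintro x ⟨z, hz, hzx⟩ y hy
        refine hz y fun j hj => ?_
        rw [hy j hj]
        exact (congrFun hzx ⟨j, Finset.mem_Icc.2 (abs_le.1 hj)⟩).symm
      rw [hV, ← sum_measure_preimage_singleton _ fun v _ => hrm (MeasurableSet.singleton v),
        ← sum_measure_preimage_singleton _ fun v _ => hrm (MeasurableSet.singleton v),
        Finset.mul_sum]
      exact Finset.sum_le_sum fun v _ => h (m + L) (by omega) v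
    rw [hVU, hVmono.measure_iUnion]
    refine iSup_le fun m => (hVle m).trans ?_
    gcongr
    exact Set.subset_iUnion V m
  intro s hs
  refine le_antisymm (ENNReal.le_of_forall_pos_le_add fun ε hε _ => ?_) zero_le
  have hδ : (ε : ENNReal) / (C + 1) ≠ 0 := by
    simp [hε.ne', ENNReal.add_eq_top]
  obtain ⟨U, hsU, hU, hUlt⟩ := s.exists_isOpen_lt_of_lt _ (hs.trans_lt (pos_iff_ne_zero.2 hδ))
  calc ν₁ s ≤ ν₁ U := measure_mono hsU
    _ ≤ C * ν₂ U := hopen U hU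
    _ ≤ (C + 1) * (ε / (C + 1)) := by gcongr; exact le_self_add
    _ ≤ ε := ENNReal.mul_div_le
    _ = 0 + ε := (zero_add _).symm

lemma abs_apply_le_of_fixes {σ : Equiv.Perm ℤ} {L : ℕ}
    (hL : ∀ n : ℤ, (L : ℤ) ≤ |n| → σ n = n) {m : ℕ} (hm : L ≤ m) {j : ℤ}
    (hj : |j| ≤ (m : ℤ)) : |σ j| ≤ (m : ℤ) := by
  by_contra! hlt
  have : σ j = j := σ.injective (hL _ (by omega))
  rw [this] at hlt
  omega

/-- Within `Σ_Λ`, membership of `T_σ y` in `Σ_Λ` depends only on a bounded window of `y`. -/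
lemma Tmap_mem_SigmaSFT_of_agree {N : ℕ} {Λ : Fin N → Fin N → Bool} {σ : Equiv.Perm ℤ} {L : ℕ}
    (hL : ∀ n : ℤ, (L : ℤ) ≤ |n| → σ n = n) {m : ℕ} (hm : L ≤ m) {x y : ℤ → Fin N}
    (hx : Tmap σ x ∈ SigmaSFT Λ) (hy : y ∈ SigmaSFT Λ)
    (hxy : ∀ j : ℤ, |j| ≤ (m : ℤ) → y j = x j) : Tmap σ y ∈ SigmaSFT Λ := by
  intro i
  change Λ (y (σ i)) (y (σ (i + 1))) = true
  by_cases h : |i| ≤ (m : ℤ) ∧ |i + 1| ≤ (m : ℤ)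
  · rw [hxy _ (abs_apply_le_of_fixes hL hm h.1), hxy _ (abs_apply_le_of_fixes hL hm h.2)]
    exact hx i
  · have h1 : (m : ℤ) ≤ |i| ∧ (m : ℤ) ≤ |i + 1| := by
      simp only [abs_le, le_abs] at h ⊢
      omega
    rw [hL i (by omega), hL (i + 1) (by omega)]
    exact hy i

/-- a Gibbs measure on a topologically mixing SFT, for a potential `φ ∈ F_Λ`,
is quasi-invariant under every finitely supported involution of `ℤ`. -/
theorem gibbs_quasiInvariant
    {N : ℕ} (Λ : Fin N → Fin N → Bool)
    (hsymb : ∀ j : Fin N, ∃ x ∈ SigmaSFT Λ, x 0 = j)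
    (hmix : ∃ M : ℕ, 0 < M ∧ ∀ i j : Fin N, ∃ w : ℕ → Fin N,
      w 0 = i ∧ w M = j ∧ ∀ l : ℕ, l < M → Λ (w l) (w (l + 1)) = true)
    (φ : (ℤ → Fin N) → ℝ) (hφcont : ContinuousOn φ (SigmaSFT Λ))
    (hvar : ∃ b > (0 : ℝ), ∃ α ∈ Set.Ioo (0 : ℝ) 1, ∀ k : ℕ,
      ∀ x ∈ SigmaSFT Λ, ∀ y ∈ SigmaSFT Λ,
        (∀ j : ℤ, |j| ≤ (k : ℤ) → x j = y j) → |φ x - φ y| ≤ b * α ^ k)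
    (μ : Measure (ℤ → Fin N)) (c₁ c₂ p : ℝ) (hGibbs : IsGibbs Λ φ μ c₁ c₂ p)
    (σ : Equiv.Perm ℤ) (hσ : FinitelySupported σ) (hσinv : ∀ n, σ (σ n) = n) :
    ((μ.map (Tmap ⇑σ)).restrict (SigmaSFT Λ ∩ Tmap ⇑σ ⁻¹' SigmaSFT Λ) ≪
        μ.restrict (SigmaSFT Λ ∩ Tmap ⇑σ ⁻¹' SigmaSFT Λ)) ∧
    (μ.restrict (SigmaSFT Λ ∩ Tmap ⇑σ ⁻¹' SigmaSFT Λ) ≪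
        (μ.map (Tmap ⇑σ)).restrict (SigmaSFT Λ ∩ Tmap ⇑σ ⁻¹' SigmaSFT Λ)) := by
  obtain ⟨L, hL⟩ := hσ
  have hGibbs' := hGibbs
  obtain ⟨hprob, -⟩ := hGibbs'
  obtain ⟨C, hC⟩ := exists_measure_symmCylSFT_le hφcont hvar hGibbs L
  have hT := measurable_Tmap N σ
  have hTT : ∀ x : ℤ → Fin N, Tmap σ (Tmap σ x) = x := fun x => by
    funext n; simp [Tmap, hσinv]
  have hSig := (isClosed_SigmaSFT Λ).measurableSet
  have hΓ : MeasurableSet (SigmaSFT Λ ∩ Tmap ⇑σ ⁻¹' SigmaSFT Λ) := hSig.inter (hT hSig)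
  have hTΓ : Tmap ⇑σ ⁻¹' (SigmaSFT Λ ∩ Tmap ⇑σ ⁻¹' SigmaSFT Λ) =
      SigmaSFT Λ ∩ Tmap ⇑σ ⁻¹' SigmaSFT Λ := by
    ext x; simp [hTT, and_comm]
  have hac : (μ.map (Tmap ⇑σ)).restrict (SigmaSFT Λ ∩ Tmap ⇑σ ⁻¹' SigmaSFT Λ) ≪
      μ.restrict (SigmaSFT Λ ∩ Tmap ⇑σ ⁻¹' SigmaSFT Λ) := by
    refine absolutelyContinuous_of_restrict_Icc C L fun m hm v => ?_
    have hA : MeasurableSet ((Finset.Icc (-(m : ℤ)) m).restrict (π := fun _ => Fin N) ⁻¹' {v}) :=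
      Finset.measurable_restrict _ (MeasurableSet.singleton v)
    rw [Measure.restrict_apply hA, Measure.restrict_apply hA, Measure.map_apply hT (hA.inter hΓ),
      Set.preimage_inter, hTΓ]
    have hv : ∀ x, x ∈ (Finset.Icc (-(m : ℤ)) m).restrict (π := fun _ => Fin N) ⁻¹' {v} →
        ∀ y, y ∈ (Finset.Icc (-(m : ℤ)) m).restrict (π := fun _ => Fin N) ⁻¹' {v} ↔
          ∀ j : ℤ, |j| ≤ (m : ℤ) → y j = x j := by
      rintro x rfl y
      simp only [Set.mem_preimage, Set.mem_singleton_iff, funext_iff, Subtype.forall,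
        Finset.mem_Icc, Finset.restrict, abs_le]
    rcases (((Finset.Icc (-(m : ℤ)) m).restrict (π := fun _ => Fin N) ⁻¹' {v}) ∩
      (SigmaSFT Λ ∩ Tmap ⇑σ ⁻¹' SigmaSFT Λ)).eq_empty_or_nonempty with he | ⟨x, hxv, hxS, hTx⟩
    · have : Tmap ⇑σ ⁻¹' ((Finset.Icc (-(m : ℤ)) m).restrict (π := fun _ => Fin N) ⁻¹' {v}) ∩
          (SigmaSFT Λ ∩ Tmap ⇑σ ⁻¹' SigmaSFT Λ) = ∅ := by
        rw [← hTΓ, ← Set.preimage_inter, he, Set.preimage_empty]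
      rw [this, measure_empty]
      exact zero_le
    · calc _ ≤ μ (symmCylSFT Λ (Tmap σ x) m) := by
            refine measure_mono ?_
            rintro y ⟨hy, hyS, -⟩
            refine ⟨hyS, fun j hj => ?_⟩
            have := (hv x hxv _).1 hy (σ j) (abs_apply_le_of_fixes hL hm hj)
            simpa [Tmap, hσinv] using this
        _ ≤ C * μ (symmCylSFT Λ x m) :=
            hC _ hTx _ hxS (fun j hj => by simp [Tmap, hL j hj]) m
        _ ≤ _ := by
            gcongr
            rintro y ⟨hyS, hy⟩
            exact ⟨(hv x hxv y).2 hy, hyS, Tmap_mem_SigmaSFT_of_agree hL hm hTx hyS hy⟩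
  refine ⟨hac, Measure.AbsolutelyContinuous.mk fun s hs h0 => ?_⟩
  rw [Measure.restrict_apply hs, Measure.map_apply hT (hs.inter hΓ), Set.preimage_inter,
    hTΓ, ← Measure.restrict_apply (hT hs)] at h0
  have h1 := hac h0
  rw [Measure.restrict_apply (hT hs), Measure.map_apply hT ((hT hs).inter hΓ),
    Set.preimage_inter, hTΓ, ← Set.preimage_comp] at h1
  rw [Measure.restrict_apply hs]
  have hcomp : Tmap (K := Fin N) σ ∘ Tmap σ = id := funext hTT
  rwa [hcomp, Set.preimage_id] at h1
end

section
/- Let Σ_Λ be a subshift of finite type, φ : Σ_Λ → ℝ with φ(x) = φ(y) whenever x_j = y_j for all j ≥ 0 and var_k φ ≤ b α^k for all k ≥ 0, and let μ be a Gibbs measure for φ with constants c_1, c_2, p. Let σ ∈ H be an involution and M(σ) the smallest natural number with σ(j) = j for all |j| ≥ M(σ). Then there is a constant C > 0 such that for every x ∈ Σ_Λ ∩ T_σ^{-1}Σ_Λ and every N ≥ M(σ), writing C_N(x) = {y ∈ Σ_Λ : y_j = x_j, −N ≤ j ≤ N}, one has (c_1/c_2)·e^{−C} ≤ μ(T_σ^{-1}C_N(x))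 / μ(C_N(x)) ≤ (c_2/c_1)·e^{C}. -/
open MeasureTheory Filter Topology

/-- The symmetric cylinder `{y ∈ Σ_Λ : y_j = x_j, -n ≤ j ≤ n}`. -/
def symmCyl {N : ℕ} (Λ : Fin N → Fin N → Bool) (x : ℤ → Fin N) (n : ℕ) : Set (ℤ → Fin N) :=
  {y ∈ SigmaSFT Λ | ∀ j : ℤ, -(n : ℤ) ≤ j → j ≤ (n : ℤ) → y j = x j}

lemma measurableSet_SigmaSFT {N : ℕ} (Λ : Fin N → Fin N → Bool) :
    MeasurableSet (SigmaSFT Λ) := by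
  have h : SigmaSFT Λ = ⋂ i : ℤ, (fun x : ℤ → Fin N => (x i, x (i + 1))) ⁻¹'
      {q | Λ q.1 q.2 = true} := by
    ext x; simp [SigmaSFT]
  rw [h]
  exact MeasurableSet.iInter fun i =>
    ((measurable_pi_apply i).prodMk (measurable_pi_apply (i + 1))) (Set.toFinite _).measurableSet

lemma measurableSet_symmCyl {N : ℕ} (Λ : Fin N → Fin N → Bool) (x : ℤ → Fin N) (n : ℕ) :
    MeasurableSet (symmCyl Λ x n) := by
  have h : symmCyl Λ x n = SigmaSFT Λ ∩ ⋂ j ∈ Set.Icc (-(n : ℤ)) n,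
      (fun y : ℤ → Fin N => y j) ⁻¹' {x j} := by
    ext y; simp [symmCyl]
  rw [h]
  exact (measurableSet_SigmaSFT Λ).inter <| MeasurableSet.biInter (Set.to_countable _)
    fun j _ => measurable_pi_apply j (MeasurableSet.singleton _)

lemma translate_mem_SigmaSFT {N : ℕ} {Λ : Fin N → Fin N → Bool} {x : ℤ → Fin N}
    (hx : x ∈ SigmaSFT Λ) (k : ℤ) : (fun i => x (i + k)) ∈ SigmaSFT Λ := by
  intro i
  have := hx (i + k)
  rwa [add_right_comm] at this

lemma shiftMap_iterate_apply {K : Type*} (n : ℕ) (ω : ℤ → K) (i : ℤ) :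
    (shiftMap K)^[n] ω i = ω (i + n) := by
  induction n generalizing ω with
  | zero => simp
  | succ n ih =>
    rw [Function.iterate_succ_apply, ih]
    simp [shiftMap, add_assoc]

lemma measurable_shiftMap_s4 (K : Type*) [MeasurableSpace K] : Measurable (shiftMap K) :=
  measurable_pi_lambda _ fun n => measurable_pi_apply (n + 1)

lemma preimage_shiftMap_iterate_symmCyl {N : ℕ} (Λ : Fin N → Fin N → Bool) (x : ℤ → Fin N)
    (n : ℕ) : (shiftMap (Fin N))^[n] ⁻¹' symmCyl Λ x n =
      cylSFT Λ (fun i => x (i + -(n : ℤ))) (2 * n) := by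
  ext y
  have hy : (shiftMap (Fin N))^[n] y = fun i => y (i + n) :=
    funext fun i => shiftMap_iterate_apply n y i
  simp only [Set.mem_preimage, hy, symmCyl, cylSFT, Set.mem_ofPred_eq]
  refine and_congr ⟨fun h => ?_, fun h => translate_mem_SigmaSFT h n⟩ ⟨fun h j hj => ?_,
    fun h j h₁ h₂ => ?_⟩
  · simpa using translate_mem_SigmaSFT h (-(n : ℤ))
  · simpa using h (j + -(n : ℤ)) (by omega) (by omega)
  · obtain ⟨k, hk⟩ := Int.eq_ofNat_of_zero_le (show 0 ≤ j + n by omega)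
    have := h k (by omega)
    rw [← hk] at this
    simpa using this

lemma IsGibbs.symmCyl_bounds {N : ℕ} {Λ : Fin N → Fin N → Bool} {φ : (ℤ → Fin N) → ℝ}
    {μ : Measure (ℤ → Fin N)} {c₁ c₂ p : ℝ} (h : IsGibbs Λ φ μ c₁ c₂ p)
    {x : ℤ → Fin N} (hx : x ∈ SigmaSFT Λ) (n : ℕ) :
    c₁ * Real.exp (-(p * (2 * n : ℕ)) +
        ∑ j ∈ Finset.range (2 * n), φ (fun i => x (i + ((j : ℤ) - n)))) ≤
          (μ (symmCyl Λ x n)).toReal ∧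
      (μ (symmCyl Λ x n)).toReal ≤ c₂ * Real.exp (-(p * (2 * n : ℕ)) +
        ∑ j ∈ Finset.range (2 * n), φ (fun i => x (i + ((j : ℤ) - n)))) := by
  obtain ⟨-, -, hinv, -, -, hb⟩ := h
  have hmp : MeasurePreserving (shiftMap (Fin N)) μ μ := ⟨measurable_shiftMap_s4 _, hinv⟩
  have := hb _ (translate_mem_SigmaSFT hx (-(n : ℤ))) (2 * n)
  rw [← preimage_shiftMap_iterate_symmCyl, (hmp.iterate n).measure_preimage
    (measurableSet_symmCyl Λ x n).nullMeasurableSet] at this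
  simpa only [add_assoc, sub_eq_add_neg] using this

/-- On `Σ_Λ`, the preimage of a symmetric cylinder under `T_σ` is a symmetric cylinder. -/
lemma preimage_Tmap_symmCyl_inter {N : ℕ} {Λ : Fin N → Fin N → Bool} {σ : Equiv.Perm ℤ}
    (hσinv : ∀ n, σ (σ n) = n) {M : ℕ} (hM : ∀ j : ℤ, (M : ℤ) ≤ |j| → σ j = j)
    {x : ℤ → Fin N} (hx : x ∈ SigmaSFT Λ) {n : ℕ} (hn : M ≤ n) :
    Tmap ⇑σ ⁻¹' symmCyl Λ x n ∩ SigmaSFT Λ = symmCyl Λ (Tmap ⇑σ x) n := by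
  have hfix : ∀ j : ℤ, (n : ℤ) ≤ |j| → σ j = j := fun j hj => hM j (by omega)
  have hmaps : ∀ j : ℤ, |j| ≤ n → |σ j| ≤ n := by
    intro j hj
    by_contra! hc
    have := hfix (σ j) hc.le
    rw [hσinv] at this
    rw [← this] at hc
    omega
  ext y
  simp only [symmCyl, Set.mem_inter_iff, Set.mem_preimage, Set.mem_ofPred_eq, Tmap]
  constructor
  · rintro ⟨⟨-, h⟩, hy⟩
    refine ⟨hy, fun j h₁ h₂ => ?_⟩
    have := abs_le.1 (hmaps j (abs_le.2 ⟨h₁, h₂⟩))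
    simpa [hσinv] using h (σ j) this.1 this.2
  · rintro ⟨hy, h⟩
    have hin : ∀ j : ℤ, |j| ≤ n → y (σ j) = x j := by
      intro j hj
      have := abs_le.1 (hmaps j hj)
      simpa [hσinv] using h (σ j) this.1 this.2
    refine ⟨⟨fun i => ?_, fun j h₁ h₂ => hin j (abs_le.2 ⟨h₁, h₂⟩)⟩, hy⟩
    change Λ (y (σ i)) (y (σ (i + 1))) = true
    by_cases h : |i| ≤ n ∧ |i + 1| ≤ n
    · rw [hin _ h.1, hin _ h.2]
      exact hx i
    · have h' : (n : ℤ) ≤ |i| ∧ (n : ℤ) ≤ |i + 1| := by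
        simp only [abs_le, le_abs] at h ⊢
        omega
      rw [hfix _ h'.1, hfix _ h'.2]
      exact hy i

lemma exists_abs_le_of_var_zero {N : ℕ} {Λ : Fin N → Fin N → Bool}
    (hsymb : ∀ j : Fin N, ∃ x ∈ SigmaSFT Λ, x 0 = j) {φ : (ℤ → Fin N) → ℝ} {b : ℝ} (hb : 0 ≤ b)
    (hvar : ∀ x ∈ SigmaSFT Λ, ∀ y ∈ SigmaSFT Λ, x 0 = y 0 → |φ x - φ y| ≤ b) :
    ∃ B : ℝ, 0 ≤ B ∧ ∀ x ∈ SigmaSFT Λ, |φ x| ≤ B := by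
  choose r hr hr0 using hsymb
  refine ⟨∑ j, |φ (r j)| + b, by positivity, fun x hx => ?_⟩
  have h₁ := hvar x hx (r (x 0)) (hr _) (hr0 _).symm
  have h₂ : |φ (r (x 0))| ≤ ∑ j, |φ (r j)| :=
    Finset.single_le_sum (f := fun j => |φ (r j)|) (fun _ _ => abs_nonneg _) (Finset.mem_univ _)
  have h₃ := abs_sub_abs_le_abs_sub (φ x) (φ (r (x 0)))
  linarith

/-- Orbits of two points that agree outside `(-M, M)` have exponentially close values of `φ`. -/
lemma abs_sub_translate_le {N : ℕ} {Λ : Fin N → Fin N → Bool} {φ : (ℤ → Fin N) → ℝ}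
    (hdep : ∀ x ∈ SigmaSFT Λ, ∀ y ∈ SigmaSFT Λ, (∀ j : ℤ, 0 ≤ j → x j = y j) → φ x = φ y)
    {b α : ℝ} (hb : 0 ≤ b) (hα : α ∈ Set.Ioo (0 : ℝ) 1)
    (hvar : ∀ k : ℕ, ∀ x ∈ SigmaSFT Λ, ∀ y ∈ SigmaSFT Λ,
      (∀ j : ℤ, |j| ≤ (k : ℤ) → x j = y j) → |φ x - φ y| ≤ b * α ^ k)
    {B : ℝ} (hB0 : 0 ≤ B) (hB : ∀ x ∈ SigmaSFT Λ, |φ x| ≤ B) {M : ℕ} {x z : ℤ → Fin N}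
    (hx : x ∈ SigmaSFT Λ) (hz : z ∈ SigmaSFT Λ) (hxz : ∀ j : ℤ, (M : ℤ) ≤ |j| → z j = x j)
    (k : ℤ) :
    |φ (fun i => z (i + k)) - φ (fun i => x (i + k))| ≤ (2 * B + b) / α ^ M * α ^ k.natAbs := by
  obtain ⟨h0, h1⟩ := hα
  have hzk := translate_mem_SigmaSFT hz k
  have hxk := translate_mem_SigmaSFT hx k
  by_cases hk : (M : ℤ) ≤ k
  · rw [hdep _ hzk _ hxk fun j hj => hxz _ (le_abs.2 (by omega)), sub_self, abs_zero]
    positivity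
  rw [div_mul_eq_mul_div, le_div_iff₀ (by positivity)]
  by_cases hk' : k ≤ -(M : ℤ)
  · obtain ⟨m, hm⟩ := Nat.exists_eq_add_of_le (show M ≤ k.natAbs by omega)
    have h := hvar m _ hzk _ hxk fun j hj => hxz _ <| by
      rw [abs_le] at hj
      rw [le_abs]
      omega
    calc _ ≤ b * α ^ m * α ^ M := by gcongr
      _ = b * α ^ k.natAbs := by rw [hm, pow_add]; ring
      _ ≤ _ := by gcongr; linarith
  · have h : |φ (fun i => z (i + k)) - φ (fun i => x (i + k))| ≤ 2 * B + b := by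
      have := abs_sub (φ (fun i => z (i + k))) (φ (fun i => x (i + k)))
      linarith [hB _ hzk, hB _ hxk]
    have hp : α ^ M ≤ α ^ k.natAbs := pow_le_pow_of_le_one h0.le h1.le (by omega)
    exact mul_le_mul h hp (by positivity) (by linarith)

lemma sum_range_pow_natAbs_sub_le {α : ℝ} (hα : α ∈ Set.Ioo (0 : ℝ) 1) (n : ℕ) :
    ∑ j ∈ Finset.range (2 * n), α ^ ((j : ℤ) - n).natAbs ≤ 2 / (1 - α) := by
  obtain ⟨h0, h1⟩ := hα
  have hgeom : ∑ j ∈ Finset.range n, α ^ j ≤ 1 / (1 - α) := by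
    rw [one_div, ← tsum_geometric_of_lt_one h0.le h1]
    exact (summable_geometric_of_lt_one h0.le h1).sum_le_tsum _ fun _ _ => by positivity
  rw [two_mul, Finset.sum_range_add, ← Finset.sum_range_reflect]
  have hle : ∑ j ∈ Finset.range n, α ^ (((n - 1 - j : ℕ) : ℤ) - n).natAbs ≤
      ∑ j ∈ Finset.range n, α ^ j := by
    refine Finset.sum_le_sum fun j hj => pow_le_pow_of_le_one h0.le h1.le ?_
    have := Finset.mem_range.1 hj
    omega
  have heq : ∑ j ∈ Finset.range n, α ^ (((n + j : ℕ) : ℤ) - n).natAbs =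
      ∑ j ∈ Finset.range n, α ^ j :=
    Finset.sum_congr rfl fun j _ => by congr 1; omega
  rw [heq]
  have : 2 / (1 - α) = 1 / (1 - α) + 1 / (1 - α) := by ring
  linarith

lemma div_bounds_of_exp_bounds {c₁ c₂ C s t u v : ℝ} (hc₁ : 0 < c₁) (hc₂ : 0 < c₂)
    (hst : |s - t| ≤ C) (hu₁ : c₁ * Real.exp s ≤ u) (hu₂ : u ≤ c₂ * Real.exp s)
    (hv₁ : c₁ * Real.exp t ≤ v) (hv₂ : v ≤ c₂ * Real.exp t) :
    c₁ / c₂ * Real.exp (-C) ≤ u / v ∧ u / v ≤ c₂ / c₁ * Real.exp C := by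
  have hv : 0 < v := lt_of_lt_of_le (by positivity) hv₁
  obtain ⟨h₁, h₂⟩ := abs_le.1 hst
  constructor
  · rw [le_div_iff₀ hv]
    calc _ ≤ c₁ / c₂ * Real.exp (-C) * (c₂ * Real.exp t) := by gcongr
      _ = c₁ * Real.exp (-C + t) := by rw [Real.exp_add]; field_simp
      _ ≤ c₁ * Real.exp s := by gcongr; linarith
      _ ≤ u := hu₁
  · rw [div_le_iff₀ hv]
    calc u ≤ c₂ * Real.exp s := hu₂
      _ ≤ c₂ * Real.exp (C + t) := by gcongr; linarith
      _ = c₂ / c₁ * Real.exp C * (c₁ * Real.exp t) := by rw [Real.exp_add]; field_simp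
      _ ≤ _ := by gcongr

/-- uniform bound on the ratio `μ(T_σ⁻¹ C_N(x)) / μ(C_N(x))` over symmetric
cylinders `C_N(x)`, `N ≥ M(σ)`, `x ∈ Σ_Λ ∩ T_σ⁻¹ Σ_Λ`. -/
theorem gibbs_cylinder_ratio_bound
    {N : ℕ} (Λ : Fin N → Fin N → Bool)
    (hsymb : ∀ j : Fin N, ∃ x ∈ SigmaSFT Λ, x 0 = j)
    (φ : (ℤ → Fin N) → ℝ)
    (hdep : ∀ x ∈ SigmaSFT Λ, ∀ y ∈ SigmaSFT Λ,
      (∀ j : ℤ, 0 ≤ j → x j = y j) → φ x = φ y)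
    (b α : ℝ) (hb : 0 < b) (hα : α ∈ Set.Ioo (0 : ℝ) 1)
    (hvar : ∀ k : ℕ, ∀ x ∈ SigmaSFT Λ, ∀ y ∈ SigmaSFT Λ,
      (∀ j : ℤ, |j| ≤ (k : ℤ) → x j = y j) → |φ x - φ y| ≤ b * α ^ k)
    (μ : Measure (ℤ → Fin N)) (c₁ c₂ p : ℝ) (hGibbs : IsGibbs Λ φ μ c₁ c₂ p)
    (σ : Equiv.Perm ℤ) (hσ : FinitelySupported σ) (hσinv : ∀ n, σ (σ n) = n)
    (M : ℕ) (hM : ∀ j : ℤ, (M : ℤ) ≤ |j| → σ j = j)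
    (hMmin : ∀ M' : ℕ, (∀ j : ℤ, (M' : ℤ) ≤ |j| → σ j = j) → M ≤ M') :
    ∃ C : ℝ, 0 < C ∧
      ∀ x ∈ SigmaSFT Λ ∩ Tmap ⇑σ ⁻¹' SigmaSFT Λ, ∀ n : ℕ, M ≤ n →
        (c₁ / c₂) * Real.exp (-C) ≤
            (μ (Tmap ⇑σ ⁻¹' {y ∈ SigmaSFT Λ | ∀ j : ℤ, -(n : ℤ) ≤ j → j ≤ (n : ℤ) → y j = x j})).toReal /
              (μ {y ∈ SigmaSFT Λ | ∀ j : ℤ, -(n : ℤ) ≤ j → j ≤ (n : ℤ) → y j = x j}).toReal ∧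
          (μ (Tmap ⇑σ ⁻¹' {y ∈ SigmaSFT Λ | ∀ j : ℤ, -(n : ℤ) ≤ j → j ≤ (n : ℤ) → y j = x j})).toReal /
              (μ {y ∈ SigmaSFT Λ | ∀ j : ℤ, -(n : ℤ) ≤ j → j ≤ (n : ℤ) → y j = x j}).toReal ≤
            (c₂ / c₁) * Real.exp C := by
  obtain ⟨B, hB0, hB⟩ := exists_abs_le_of_var_zero hsymb hb.le fun x hx y hy h => by
    simpa using hvar 0 x hx y hy fun j hj => by
      obtain rfl : j = 0 := by simpa using hj
      exact h
  have h0 := hα.1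
  have h1 : 0 < 1 - α := sub_pos.2 hα.2
  refine ⟨(2 * B + b) / α ^ M * (2 / (1 - α)), by positivity, ?_⟩
  rintro x ⟨hx, hz⟩ n hn
  have := hGibbs.1
  have hμ : μ (Tmap ⇑σ ⁻¹' symmCyl Λ x n) = μ (symmCyl Λ (Tmap ⇑σ x) n) := by
    rw [← preimage_Tmap_symmCyl_inter hσinv hM hx hn]
    refine (measure_inter_conull ?_).symm
    exact (prob_compl_eq_zero_iff (measurableSet_SigmaSFT Λ)).2 hGibbs.2.1
  change _ ≤ (μ (Tmap ⇑σ ⁻¹' symmCyl Λ x n)).toReal / (μ (symmCyl Λ x n)).toReal ∧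
    (μ (Tmap ⇑σ ⁻¹' symmCyl Λ x n)).toReal / (μ (symmCyl Λ x n)).toReal ≤ _
  rw [hμ]
  obtain ⟨hu₁, hu₂⟩ := hGibbs.symmCyl_bounds (x := Tmap ⇑σ x) hz n
  obtain ⟨hv₁, hv₂⟩ := hGibbs.symmCyl_bounds hx n
  refine div_bounds_of_exp_bounds hGibbs.2.2.2.1 hGibbs.2.2.2.2.1 ?_ hu₁ hu₂ hv₁ hv₂
  rw [add_sub_add_left_eq_sub, ← Finset.sum_sub_distrib]
  calc _ ≤ ∑ j ∈ Finset.range (2 * n), (2 * B + b) / α ^ M * α ^ ((j : ℤ) - n).natAbs :=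
        (Finset.abs_sum_le_sum_abs _ _).trans <| Finset.sum_le_sum fun j _ =>
          abs_sub_translate_le hdep hb.le hα hvar hB0 hB hx hz
            (fun i hi => by simp [Tmap, hM i hi]) _
    _ ≤ _ := by
      rw [← Finset.mul_sum]
      exact mul_le_mul_of_nonneg_left (sum_range_pow_natAbs_sub_le hα n) (by positivity)
end

section
/- Let Σ_Λ be a subshift of finite type and φ : Σ_Λ → ℝ with φ(x) = φ(y) whenever x_j = y_j for all j ≥ 0 and var_k φ ≤ b α^k for all k ≥ 0 (b > 0, α ∈ (0,1)). Let τ ∈ H and let M(τ) be the smallest natural number with τ(j) = j for all |j| ≥ M(τ). Then for every x ∈ Σ_Λ with T_τ x ∈ Σ_Λ, the sequence G_N(x) := Σ_{q=−N}^{N−1} (φ(S^q T_τ x) − φ(S^q x)) converges as N → ∞ to Σ_{q∈ℤ} (φ(S^q T_τ x) − φ(S^q x)), and there exists a constant C (depending only on φ and τ) such that |G_N(x)| ≤ C for all N ≥ M(τ) and all such x. -/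
open MeasureTheory Filter Topology

theorem add_shift_mem_SigmaSFT {N : ℕ} {Λ : Fin N → Fin N → Bool} {x : ℤ → Fin N}
    (hx : x ∈ SigmaSFT Λ) (q : ℤ) : (fun i => x (i + q)) ∈ SigmaSFT Λ := by
  intro i
  have h := hx (i + q)
  rwa [add_right_comm] at h

/-- A function whose oscillation on each cylinder `{x | x 0 = j}` is at most `b` is bounded. -/
theorem exists_abs_le_of_oscillation_le {N : ℕ} {Λ : Fin N → Fin N → Bool}
    (hsymb : ∀ j : Fin N, ∃ x ∈ SigmaSFT Λ, x 0 = j) {φ : (ℤ → Fin N) → ℝ} {b : ℝ}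
    (hosc : ∀ x ∈ SigmaSFT Λ, ∀ y ∈ SigmaSFT Λ, x 0 = y 0 → |φ x - φ y| ≤ b) :
    ∃ B : ℝ, 0 ≤ B ∧ ∀ x ∈ SigmaSFT Λ, |φ x| ≤ B := by
  choose p hp hp0 using hsymb
  refine ⟨|b| + ∑ j, |φ (p j)|, by positivity, fun x hx => ?_⟩
  have h1 := hosc x hx (p (x 0)) (hp _) (hp0 _).symm
  have h2 : |φ (p (x 0))| ≤ ∑ j, |φ (p j)| :=
    Finset.single_le_sum (f := fun j => |φ (p j)|) (fun _ _ => abs_nonneg _) (Finset.mem_univ _)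
  have h3 := abs_sub_abs_le_abs_sub (φ x) (φ (p (x 0)))
  linarith [le_abs_self b]

theorem summable_pow_natAbs {α : ℝ} (h0 : 0 ≤ α) (h1 : α < 1) :
    Summable fun q : ℤ => α ^ q.natAbs :=
  Summable.of_nat_of_neg (by simpa using summable_geometric_of_lt_one h0 h1)
    (by simpa using summable_geometric_of_lt_one h0 h1)

theorem tendsto_Icc_neg_sub_one_atTop :
    Tendsto (fun n : ℕ => Finset.Icc (-(n : ℤ)) ((n : ℤ) - 1)) atTop atTop := by
  refine tendsto_atTop_finset_of_monotone (fun m n hmn => ?_) fun q => ⟨q.natAbs + 1, ?_⟩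
  · exact Finset.Icc_subset_Icc (by omega) (by omega)
  · rw [Finset.mem_Icc]
    omega

/-- The terms of the cocycle decay geometrically, uniformly in `x`. -/
theorem exists_abs_cocycle_term_le {N : ℕ} {Λ : Fin N → Fin N → Bool}
    (hsymb : ∀ j : Fin N, ∃ x ∈ SigmaSFT Λ, x 0 = j) {φ : (ℤ → Fin N) → ℝ}
    (hdep : ∀ x ∈ SigmaSFT Λ, ∀ y ∈ SigmaSFT Λ,
      (∀ j : ℤ, 0 ≤ j → x j = y j) → φ x = φ y)
    {b α : ℝ} (hb : 0 < b) (hα : α ∈ Set.Ioo (0 : ℝ) 1)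
    (hvar : ∀ k : ℕ, ∀ x ∈ SigmaSFT Λ, ∀ y ∈ SigmaSFT Λ,
      (∀ j : ℤ, |j| ≤ (k : ℤ) → x j = y j) → |φ x - φ y| ≤ b * α ^ k)
    {τ : ℤ → ℤ} {M : ℕ} (hM : ∀ j : ℤ, (M : ℤ) ≤ |j| → τ j = j) :
    ∃ D : ℝ, ∀ x ∈ SigmaSFT Λ, Tmap τ x ∈ SigmaSFT Λ → ∀ q : ℤ,
      |φ (fun i => Tmap τ x (i + q)) - φ (fun i => x (i + q))| ≤ D * α ^ q.natAbs := by
  obtain ⟨hα0, hα1⟩ := hα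
  obtain ⟨B, hB0, hB⟩ := exists_abs_le_of_oscillation_le hsymb (φ := φ) (b := b)
    fun x hx y hy hxy => by
      simpa using hvar 0 x hx y hy fun j hj => by
        obtain rfl : j = 0 := by simpa using hj
        exact hxy
  refine ⟨(b + 2 * B) * (α ^ M)⁻¹, fun x hx hTx q => ?_⟩
  have hxq := add_shift_mem_SigmaSFT hx q
  have hTq := add_shift_mem_SigmaSFT hTx q
  have hαM : 0 < α ^ M := by positivity
  rw [mul_assoc, ← div_eq_inv_mul]
  rcases le_or_gt (M : ℤ) q with hq | hq
  · rw [hdep _ hTq _ hxq fun j hj => congrArg x (hM _ (by rw [le_abs]; omega)), sub_self,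
      abs_zero]
    positivity
  rcases le_or_gt q (-(M : ℤ)) with hq' | hq'
  · obtain ⟨k, hk⟩ := Nat.exists_eq_add_of_le (show M ≤ q.natAbs by omega)
    have h := hvar k _ hTq _ hxq fun j hj =>
      congrArg x (hM _ (by rw [le_abs]; rw [abs_le] at hj; omega))
    rw [hk, pow_add, mul_div_cancel_left₀ _ hαM.ne']
    have : 0 ≤ B * α ^ k := by positivity
    linarith
  · have h1 : 1 ≤ α ^ q.natAbs / α ^ M := by
      rw [one_le_div hαM]
      exact pow_le_pow_of_le_one hα0.le hα1.le (by omega)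
    calc _ ≤ |φ (fun i => Tmap τ x (i + q))| + |φ (fun i => x (i + q))| := abs_sub _ _
      _ ≤ b + 2 * B := by linarith [hB _ hTq, hB _ hxq]
      _ ≤ _ := le_mul_of_one_le_right (by positivity) h1

/-- for `τ ∈ H` and potentials depending on nonnegative coordinates with
exponentially decreasing variation, `G_N(x) = ∑_{q=-N}^{N-1} (φ(S^q T_τ x) - φ(S^q x))`
converges to `∑_{q ∈ ℤ} (φ(S^q T_τ x) - φ(S^q x))`, with a uniform bound `|G_N(x)| ≤ C`
for all `N ≥ M(τ)`. -/
theorem cocycle_sum_converges_and_bounded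
    {N : ℕ} (Λ : Fin N → Fin N → Bool)
    (hsymb : ∀ j : Fin N, ∃ x ∈ SigmaSFT Λ, x 0 = j)
    (φ : (ℤ → Fin N) → ℝ)
    (hdep : ∀ x ∈ SigmaSFT Λ, ∀ y ∈ SigmaSFT Λ,
      (∀ j : ℤ, 0 ≤ j → x j = y j) → φ x = φ y)
    (b α : ℝ) (hb : 0 < b) (hα : α ∈ Set.Ioo (0 : ℝ) 1)
    (hvar : ∀ k : ℕ, ∀ x ∈ SigmaSFT Λ, ∀ y ∈ SigmaSFT Λ,
      (∀ j : ℤ, |j| ≤ (k : ℤ) → x j = y j) → |φ x - φ y| ≤ b * α ^ k)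
    (τ : Equiv.Perm ℤ) (hτ : FinitelySupported τ)
    (M : ℕ) (hM : ∀ j : ℤ, (M : ℤ) ≤ |j| → τ j = j)
    (hMmin : ∀ M' : ℕ, (∀ j : ℤ, (M' : ℤ) ≤ |j| → τ j = j) → M ≤ M') :
    (∀ x ∈ SigmaSFT Λ, Tmap ⇑τ x ∈ SigmaSFT Λ →
      Summable (fun q : ℤ => φ (fun i => Tmap ⇑τ x (i + q)) - φ (fun i => x (i + q))) ∧
      Tendsto (fun n : ℕ => ∑ q ∈ Finset.Icc (-(n : ℤ)) ((n : ℤ) - 1),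
          (φ (fun i => Tmap ⇑τ x (i + q)) - φ (fun i => x (i + q)))) atTop
        (𝓝 (∑' q : ℤ, (φ (fun i => Tmap ⇑τ x (i + q)) - φ (fun i => x (i + q)))))) ∧
    ∃ C : ℝ, ∀ x ∈ SigmaSFT Λ, Tmap ⇑τ x ∈ SigmaSFT Λ → ∀ n : ℕ, M ≤ n →
      |∑ q ∈ Finset.Icc (-(n : ℤ)) ((n : ℤ) - 1),
          (φ (fun i => Tmap ⇑τ x (i + q)) - φ (fun i => x (i + q)))| ≤ C := by
  obtain ⟨D, hD⟩ := exists_abs_cocycle_term_le hsymb hdep hb hα hvar hM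
  have hsum : Summable fun q : ℤ => D * α ^ q.natAbs :=
    (summable_pow_natAbs hα.1.le hα.2).mul_left D
  refine ⟨fun x hx hTx => ?_, ∑' q : ℤ, D * α ^ q.natAbs, fun x hx hTx n _ => ?_⟩
  · have h := Summable.of_norm_bounded hsum fun q => (Real.norm_eq_abs _).trans_le (hD x hx hTx q)
    exact ⟨h, h.hasSum.comp tendsto_Icc_neg_sub_one_atTop⟩
  · calc _ ≤ ∑ q ∈ Finset.Icc (-(n : ℤ)) ((n : ℤ) - 1), D * α ^ q.natAbs :=
        (Finset.abs_sum_le_sum_abs _ _).trans (Finset.sum_le_sum fun q _ => hD x hx hTx q)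
      _ ≤ _ := hsum.sum_le_tsum _ fun q _ => (abs_nonneg _).trans (hD x hx hTx q)
end

section
/- Let Σ_Λ be a subshift of finite type and let 1 ≤ k < P be natural numbers. With σ = σ_{P,k} the involution swapping the blocks [1,k] and [P+1,P+k], one has the identity Σ_Λ ∩ T_σ^{-1}Σ_Λ = ⋃_{(a,b),(c,d) ∈ Q} C_k(a,b,c,d) ∩ S^{-P} D_k(a,b,c,d). -/
open MeasureTheory Filter Topology

/-- `S^q`, `(S^q ω) n = ω (n + q)`. -/
def SpowMap {K : Type*} (q : ℤ) (ω : ℤ → K) : ℤ → K := fun n => ω (n + q)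

/-- The involution `σ_{P,k}` of `ℤ` swapping the blocks `[1, k]` and `[P+1, P+k]`. -/
def sigmaPK (P k : ℕ) : ℤ → ℤ := fun m =>
  if 1 ≤ m ∧ m ≤ (k : ℤ) then m + P
  else if (P : ℤ) + 1 ≤ m ∧ m ≤ (P : ℤ) + k then m - P else m

/-- `L(a) = {j : ∃ x ∈ Σ_Λ, x 0 = j, x 1 = a}`. -/
def Lset {N : ℕ} (Λ : Fin N → Fin N → Bool) (a : Fin N) : Set (Fin N) :=
  {j | ∃ x ∈ SigmaSFT Λ, x 0 = j ∧ x 1 = a}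

/-- `R(a) = {j : ∃ x ∈ Σ_Λ, x 0 = a, x 1 = j}`. -/
def Rset {N : ℕ} (Λ : Fin N → Fin N → Bool) (a : Fin N) : Set (Fin N) :=
  {j | ∃ x ∈ SigmaSFT Λ, x 0 = a ∧ x 1 = j}

/-- `Q = {(a,b) : a ∈ L(b)}`. -/
def Qset {N : ℕ} (Λ : Fin N → Fin N → Bool) : Set (Fin N × Fin N) :=
  {p | p.1 ∈ Lset Λ p.2}

/-- `C_k(a,b,c,d) = {x ∈ Σ_Λ : x_0 = a, x_1 = b, x_k = c, x_{k+1} = d}`. -/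
def Ck {N : ℕ} (Λ : Fin N → Fin N → Bool) (k : ℕ) (a b c d : Fin N) : Set (ℤ → Fin N) :=
  {x ∈ SigmaSFT Λ | x 0 = a ∧ x 1 = b ∧ x (k : ℤ) = c ∧ x ((k : ℤ) + 1) = d}

/-- `D_k(a,b,c,d) = {x ∈ Σ_Λ : x_0 ∈ L(b), x_1 ∈ R(a), x_k ∈ L(d), x_{k+1} ∈ R(c)}`. -/
def Dk {N : ℕ} (Λ : Fin N → Fin N → Bool) (k : ℕ) (a b c d : Fin N) : Set (ℤ → Fin N) :=
  {x ∈ SigmaSFT Λ |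
    x 0 ∈ Lset Λ b ∧ x 1 ∈ Rset Λ a ∧ x (k : ℤ) ∈ Lset Λ d ∧ x ((k : ℤ) + 1) ∈ Rset Λ c}

/-- A left-infinite and a right-infinite admissible word concatenate along an allowed transition. -/
theorem exists_mem_SigmaSFT_of_transition {N : ℕ} {Λ : Fin N → Fin N → Bool}
    {x y : ℤ → Fin N} (hx : x ∈ SigmaSFT Λ) (hy : y ∈ SigmaSFT Λ)
    (h : Λ (x 0) (y 0) = true) :
    ∃ z ∈ SigmaSFT Λ, z 0 = x 0 ∧ z 1 = y 0 := by
  refine ⟨fun n => if n ≤ 0 then x n else y (n - 1), fun i => ?_, by simp, by simp⟩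
  rcases lt_trichotomy i 0 with hi | rfl | hi
  · simpa [hi.le, show i + 1 ≤ 0 by lia] using hx i
  · simpa using h
  · simpa [show ¬ i ≤ 0 by lia, show ¬ i + 1 ≤ 0 by lia] using hy (i - 1)

theorem mem_Lset_iff {N : ℕ} {Λ : Fin N → Fin N → Bool}
    (hsymb : ∀ j : Fin N, ∃ x ∈ SigmaSFT Λ, x 0 = j) (j a : Fin N) :
    j ∈ Lset Λ a ↔ Λ j a = true := by
  constructor
  · rintro ⟨x, hx, rfl, rfl⟩
    exact hx 0
  · intro h
    obtain ⟨x, hx, rfl⟩ := hsymb j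
    obtain ⟨y, hy, rfl⟩ := hsymb a
    exact exists_mem_SigmaSFT_of_transition hx hy h

theorem mem_Rset_iff {N : ℕ} {Λ : Fin N → Fin N → Bool}
    (hsymb : ∀ j : Fin N, ∃ x ∈ SigmaSFT Λ, x 0 = j) (a j : Fin N) :
    j ∈ Rset Λ a ↔ Λ a j = true :=
  mem_Lset_iff hsymb a j

theorem SpowMap_mem_SigmaSFT {N : ℕ} {Λ : Fin N → Fin N → Bool} {x : ℤ → Fin N}
    (hx : x ∈ SigmaSFT Λ) (q : ℤ) : SpowMap q x ∈ SigmaSFT Λ := fun i => by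
  simpa [SpowMap, add_right_comm] using hx (i + q)

/-- Swapping two blocks of an admissible sequence gives an admissible sequence exactly when the
four transitions at the ends of the blocks are allowed. -/
theorem Tmap_sigmaPK_mem_SigmaSFT_iff {N : ℕ} {Λ : Fin N → Fin N → Bool} {k P : ℕ}
    (hk : 1 ≤ k) (hkP : k < P) {x : ℤ → Fin N} (hx : x ∈ SigmaSFT Λ) :
    Tmap (sigmaPK P k) x ∈ SigmaSFT Λ ↔
      Λ (x P) (x 1) = true ∧ Λ (x 0) (x (1 + P)) = true ∧
        Λ (x (k + P)) (x (k + 1)) = true ∧ Λ (x k) (x (k + 1 + P)) = true := by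
  constructor
  · intro h
    have key : ∀ i m n : ℤ, sigmaPK P k i = m → sigmaPK P k (i + 1) = n →
        Λ (x m) (x n) = true := by
      rintro i _ _ rfl rfl
      exact h i
    refine ⟨key P _ _ ?_ ?_, key 0 _ _ ?_ ?_, key k _ _ ?_ ?_, key (k + P) _ _ ?_ ?_⟩ <;>
      grind [sigmaPK]
  · rintro ⟨h₁, h₂, h₃, h₄⟩ i
    have key : ∀ m n : ℤ, Λ (x m) (x n) = true → sigmaPK P k i = m →
        sigmaPK P k (i + 1) = n →
        Λ (Tmap (sigmaPK P k) x i) (Tmap (sigmaPK P k) x (i + 1)) = true := by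
      rintro _ _ h rfl rfl
      exact h
    by_cases hP : i = P
    · apply key _ _ h₁ <;> grind [sigmaPK]
    by_cases h0 : i = 0
    · apply key _ _ h₂ <;> grind [sigmaPK]
    by_cases hik : i = k
    · apply key _ _ h₃ <;> grind [sigmaPK]
    by_cases hikP : i = k + P
    · apply key _ _ h₄ <;> grind [sigmaPK]
    apply key _ _ (hx (sigmaPK P k i)) rfl
    grind [sigmaPK]

/-- `Σ_Λ ∩ T_{σ_{P,k}}⁻¹ Σ_Λ = ⋃_{(a,b),(c,d) ∈ Q} C_k(a,b,c,d) ∩ S^{-P} D_k(a,b,c,d)`. -/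
theorem gamma_sigmaPK_eq_union
    {N : ℕ} (Λ : Fin N → Fin N → Bool)
    (hsymb : ∀ j : Fin N, ∃ x ∈ SigmaSFT Λ, x 0 = j)
    (k P : ℕ) (hk : 1 ≤ k) (hkP : k < P) :
    SigmaSFT Λ ∩ Tmap (sigmaPK P k) ⁻¹' SigmaSFT Λ =
      ⋃ (a : Fin N) (b : Fin N) (c : Fin N) (d : Fin N)
        (_ : (a, b) ∈ Qset Λ) (_ : (c, d) ∈ Qset Λ),
        Ck Λ k a b c d ∩ SpowMap (P : ℤ) ⁻¹' Dk Λ k a b c d := by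
  ext x
  simp only [Set.mem_iUnion, Set.mem_inter_iff, Set.mem_preimage, Ck, Dk, Qset,
    Set.mem_ofPred_eq, mem_Lset_iff hsymb, mem_Rset_iff hsymb]
  constructor
  · rintro ⟨hx, hT⟩
    rw [Tmap_sigmaPK_mem_SigmaSFT_iff hk hkP hx] at hT
    exact ⟨x 0, x 1, x k, x (k + 1), hx 0, hx k, ⟨hx, rfl, rfl, rfl, rfl⟩,
      SpowMap_mem_SigmaSFT hx P, by simpa [SpowMap] using hT⟩
  · rintro ⟨_, _, _, _, -, -, ⟨hx, rfl, rfl, rfl, rfl⟩, -, hD⟩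
    exact ⟨hx, (Tmap_sigmaPK_mem_SigmaSFT_iff hk hkP hx).2 (by simpa [SpowMap] using hD)⟩
end

section
/- Let K be a finite set, Ω = K^ℤ, and let 1 ≤ k < P and n ≥ 0 be natural numbers with k + n ≤ P. Let A_1,...,A_k, V_1,...,V_n, B_1,...,B_k be subsets of K, and let E ⊆ Ω be any set belonging to the σ-algebra generated by the coordinates ω_j, j ≤ 0. Then, with σ = σ_{P,k}, T_σ^{-1}(E ∩ F(A_1,...,A_k) ∩ S^{-k}F(V_1,...,V_n) ∩ S^{-P}F(B_1,...,B_k)) = E ∩ F(B_1,...,B_k) ∩ S^{-k}F(V_1,...,V_n) ∩ S^{-P}F(A_1,...,A_k). -/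
open MeasureTheory Filter Topology

/-- `F(W_1, ..., W_s) = {ω : ω_j ∈ W_j, 1 ≤ j ≤ s}`. -/
def Fset {K : Type*} (s : ℕ) (W : ℕ → Set K) : Set (ℤ → K) :=
  {ω | ∀ j : ℕ, 1 ≤ j → j ≤ s → ω (j : ℤ) ∈ W j}

/-- The σ-algebra `B_I` generated by the coordinates `ω_j`, `j ∈ I`. -/
def coordMS (K : Type*) [m : MeasurableSpace K] (I : Set ℤ) : MeasurableSpace (ℤ → K) :=
  ⨆ i ∈ I, m.comap fun ω => ω i

/-- Membership in a set of `coordMS K I` depends only on the coordinates in `I`. -/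
theorem mem_iff_of_measurableSet_coordMS {K : Type*} [MeasurableSpace K] {I : Set ℤ}
    {E : Set (ℤ → K)} (hE : MeasurableSet[coordMS K I] E) {ω ω' : ℤ → K}
    (h : ∀ i ∈ I, ω i = ω' i) : ω ∈ E ↔ ω' ∈ E := by
  have hle : coordMS K I ≤ MeasurableSpace.comap I.domRestrict MeasurableSpace.pi := by
    refine iSup₂_le fun i hi => ?_
    rintro _ ⟨s, hs, rfl⟩
    exact ⟨(fun x : I → K => x ⟨i, hi⟩) ⁻¹' s, measurable_pi_apply _ hs, rfl⟩
  obtain ⟨s, -, rfl⟩ := hle E hE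
  have hres : I.domRestrict ω = I.domRestrict ω' := funext fun i => h i i.2
  simp only [Set.mem_preimage, hres]

theorem sigmaPK_of_nonpos (P k : ℕ) {m : ℤ} (hm : m ≤ 0) : sigmaPK P k m = m := by
  unfold sigmaPK
  grind

theorem sigmaPK_of_mem_first (P : ℕ) {k j : ℕ} (h1 : 1 ≤ j) (hj : j ≤ k) :
    sigmaPK P k j = j + P := by
  unfold sigmaPK
  grind

theorem sigmaPK_of_mem_second {P k j : ℕ} (hkP : k ≤ P) (h1 : 1 ≤ j) (hj : j ≤ k) :
    sigmaPK P k (j + P) = j := by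
  unfold sigmaPK
  grind

theorem sigmaPK_of_mem_gap {P k n j : ℕ} (hkn : k + n ≤ P) (h1 : 1 ≤ j) (hj : j ≤ n) :
    sigmaPK P k (j + k) = j + k := by
  unfold sigmaPK
  grind

/-- for `1 ≤ k < P`, `k + n ≤ P`, `E ∈ B_{≤ 0}`, and `σ = σ_{P,k}`,
`T_σ⁻¹(E ∩ F(A) ∩ S^{-k} F(V) ∩ S^{-P} F(B)) = E ∩ F(B) ∩ S^{-k} F(V) ∩ S^{-P} F(A)`. -/
theorem Tmap_sigmaPK_preimage_eq
    {K : Type*} [Fintype K] [MeasurableSpace K] [MeasurableSingletonClass K]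
    (k P n : ℕ) (hk : 1 ≤ k) (hkP : k < P) (hkn : k + n ≤ P)
    (A V B : ℕ → Set K)
    (E : Set (ℤ → K)) (hE : MeasurableSet[coordMS K {j : ℤ | j ≤ 0}] E) :
    Tmap (sigmaPK P k) ⁻¹'
        (E ∩ Fset k A ∩ SpowMap (k : ℤ) ⁻¹' Fset n V ∩ SpowMap (P : ℤ) ⁻¹' Fset k B) =
      E ∩ Fset k B ∩ SpowMap (k : ℤ) ⁻¹' Fset n V ∩ SpowMap (P : ℤ) ⁻¹' Fset k A := by
  ext ω
  have hEω : Tmap (sigmaPK P k) ω ∈ E ↔ ω ∈ E :=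
    mem_iff_of_measurableSet_coordMS hE fun i hi => congrArg ω (sigmaPK_of_nonpos P k hi)
  have hA : Tmap (sigmaPK P k) ω ∈ Fset k A ↔ SpowMap (P : ℤ) ω ∈ Fset k A :=
    forall₃_congr fun j h1 hj => by simp only [Tmap, SpowMap, sigmaPK_of_mem_first P h1 hj]
  have hV : SpowMap (k : ℤ) (Tmap (sigmaPK P k) ω) ∈ Fset n V ↔
      SpowMap (k : ℤ) ω ∈ Fset n V :=
    forall₃_congr fun j h1 hj => by simp only [Tmap, SpowMap, sigmaPK_of_mem_gap hkn h1 hj]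
  have hB : SpowMap (P : ℤ) (Tmap (sigmaPK P k) ω) ∈ Fset k B ↔ ω ∈ Fset k B :=
    forall₃_congr fun j h1 hj => by
      simp only [Tmap, SpowMap, sigmaPK_of_mem_second hkP.le h1 hj]
  simp only [Set.mem_preimage, Set.mem_inter_iff, hEω, hA, hV, hB]
  tauto
end
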